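/- There is an absolute constant c such that for every K > 0 there exists N with the following property for all n ≥ N: if P is a set of n points in ℝ² determining at most Kn² ordinary generalised circles, and there exist two concentric circles σ₁, σ₂ such that all but at most K points of P lie on σ₁ ∪ σ₂ and the number of points of P on each of σ₁ and σ₂ differs from n/2 by at most K, then there exist an integer m ≥ 2, a real r > 1, a set V that is an aligned or offset double m-gon with radii 1 and r, and complex numbers α ≠ 0 and β, such that |P △ T(V)| ≤ cK, where T is the direct similarity of ℝ² ≅ ℂ given by T(z) = αz + β. -/

import Mathlib

noncomputable section

/-- A circle in the plane `ℝ² ≅ ℂ`: the set of points at a fixed positive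
distance from a fixed centre. -/
def IsCircle (s : Set ℂ) : Prop :=
  ∃ (c : ℂ) (ρ : ℝ), 0 < ρ ∧ s = Metric.sphere c ρ

/-- A line in the plane `ℝ² ≅ ℂ`. -/
def IsLine (s : Set ℂ) : Prop :=
  ∃ a d : ℂ, d ≠ 0 ∧ s = {z : ℂ | ∃ t : ℝ, z = a + t • d}

/-- A generalised circle is a circle or a line. -/
def IsGenCircle (s : Set ℂ) : Prop :=
  IsCircle s ∨ IsLine s

/-- The number of ordinary circles of a planar point set `P`:
circles containing exactly three points of `P`. -/
def ordinaryCircles (P : Set ℂ) : ℕ :=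
  {C : Set ℂ | IsCircle C ∧ (C ∩ P).ncard = 3}.ncard

/-- The number of ordinary generalised circles of a planar point set `P`:
generalised circles containing exactly three points of `P`. -/
def ordinaryGenCircles (P : Set ℂ) : ℕ :=
  {C : Set ℂ | IsGenCircle C ∧ (C ∩ P).ncard = 3}.ncard

/-- The number of 4-point generalised circles of a planar point set `P`:
generalised circles containing exactly four points of `P`. -/
def fourPointGenCircles (P : Set ℂ) : ℕ :=
  {C : Set ℂ | IsGenCircle C ∧ (C ∩ P).ncard = 4}.ncard

/-- The aligned double `m`-gon with radii `1` and `r`: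
`{e^{2πik/m} : 0 ≤ k < m} ∪ {r·e^{2πik/m} : 0 ≤ k < m}`. -/
def alignedDoublePolygon (m : ℕ) (r : ℝ) : Set ℂ :=
  {z : ℂ | ∃ k : ℕ, k < m ∧
    z = Complex.exp (((2 * Real.pi * (k : ℝ) / (m : ℝ) : ℝ) : ℂ) * Complex.I)} ∪
  {z : ℂ | ∃ k : ℕ, k < m ∧
    z = (r : ℂ) * Complex.exp (((2 * Real.pi * (k : ℝ) / (m : ℝ) : ℝ) : ℂ) * Complex.I)}

/-- The offset double `m`-gon with radii `1` and `r`: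
`{e^{2πik/m} : 0 ≤ k < m} ∪ {r·e^{πi(2k+1)/m} : 0 ≤ k < m}`. -/
def offsetDoublePolygon (m : ℕ) (r : ℝ) : Set ℂ :=
  {z : ℂ | ∃ k : ℕ, k < m ∧
    z = Complex.exp (((2 * Real.pi * (k : ℝ) / (m : ℝ) : ℝ) : ℂ) * Complex.I)} ∪
  {z : ℂ | ∃ k : ℕ, k < m ∧
    z = (r : ℂ) * Complex.exp (((Real.pi * (2 * (k : ℝ) + 1) / (m : ℝ) : ℝ) : ℂ) * Complex.I)}

section NearCoset

open Finset

variable {G : Type*} [CommGroup G] [DecidableEq G]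

/-- The number of elements of `B` which translation by `t` moves out of `B`. -/
def translationDefect (B : Finset G) (t : G) : ℕ := #{b ∈ B | t * b ∉ B}

/-- The number of elements of `B` which the reflection `c ↦ s / c` moves out of `B`. -/
def reflectionDefect (B : Finset G) (s : G) : ℕ := #{c ∈ B | s / c ∉ B}

lemma translationDefect_one (B : Finset G) : translationDefect B 1 = 0 := by
  simp [translationDefect]

lemma card_filter_mul_mem_add_translationDefect (B : Finset G) (t : G) :
    #{b ∈ B | t * b ∈ B} + translationDefect B t = #B :=
  card_filter_add_card_filter_not _

lemma translationDefect_inv (B : Finset G) (t : G) :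
    translationDefect B t⁻¹ = translationDefect B t := by
  have h : #{b ∈ B | t * b ∈ B} = #{b ∈ B | t⁻¹ * b ∈ B} :=
    card_bij' (fun b _ => t * b) (fun b _ => t⁻¹ * b) (by simp_all) (by simp_all)
      (by simp) (by simp)
  have h₁ := card_filter_mul_mem_add_translationDefect B t
  have h₂ := card_filter_mul_mem_add_translationDefect B t⁻¹
  omega

lemma translationDefect_mul_le (B : Finset G) (t u : G) :
    translationDefect B (t * u) ≤ translationDefect B t + translationDefect B u := by
  have hsub : {b ∈ B | t * u * b ∉ B} ⊆
      {b ∈ B | u * b ∉ B} ∪ ({b ∈ B | t * b ∉ B}).image (fun b => u⁻¹ * b) := by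
    intro b hb
    rw [mem_filter] at hb
    by_cases hu : u * b ∈ B
    · refine mem_union_right _ (mem_image.2 ⟨u * b, ?_, by simp⟩)
      exact mem_filter.2 ⟨hu, by simpa [mul_assoc] using hb.2⟩
    · exact mem_union_left _ (mem_filter.2 ⟨hb.1, hu⟩)
  have h := (card_le_card hsub).trans (card_union_le _ _)
  have h' := card_image_le (s := {b ∈ B | t * b ∉ B}) (f := fun b => u⁻¹ * b)
  unfold translationDefect
  omega

lemma translationDefect_div_le (B : Finset G) (s s' : G) :
    translationDefect B (s' / s) ≤ reflectionDefect B s + reflectionDefect B s' := by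
  have hsub : {b ∈ B | s' / s * b ∉ B} ⊆
      {c ∈ B | s / c ∉ B} ∪ ({c ∈ B | s' / c ∉ B}).image (fun c => s / c) := by
    intro b hb
    rw [mem_filter] at hb
    by_cases hs : s / b ∈ B
    · refine mem_union_right _ (mem_image.2 ⟨s / b, ?_, by simp⟩)
      refine mem_filter.2 ⟨hs, ?_⟩
      rw [show s' / (s / b) = s' / s * b by rw [div_div_eq_mul_div, div_mul_eq_mul_div]]
      exact hb.2
    · exact mem_union_left _ (mem_filter.2 ⟨hb.1, hs⟩)
  have h := (card_le_card hsub).trans (card_union_le _ _)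
  have h' := card_image_le (s := {c ∈ B | s' / c ∉ B}) (f := fun c => s / c)
  unfold translationDefect reflectionDefect
  omega

/-- Few translations have small defect. -/
lemma card_mul_card_le_of_translationDefect_le (B S : Finset G) (θ : ℝ)
    (hS : ∀ t ∈ S, (translationDefect B t : ℝ) ≤ θ) :
    (#S * #B : ℝ) ≤ (#B : ℝ) ^ 2 + #S * θ := by
  have hsum : ∑ t ∈ S, #{b ∈ B | t * b ∈ B} ≤ #B ^ 2 := by
    rw [← card_sigma, sq, ← card_product]
    refine card_le_card_of_injOn (fun x => (x.2, x.1 * x.2)) ?_ ?_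
    · rintro ⟨t, b⟩ h
      simp_all
    · rintro ⟨t, b⟩ - ⟨t', b'⟩ - h
      simp only [Prod.mk.injEq] at h
      obtain ⟨rfl, h⟩ := h
      simp_all
  have hle : ∑ _t ∈ S, (#B : ℝ) ≤ ∑ t ∈ S, ((#{b ∈ B | t * b ∈ B} : ℝ) + θ) := by
    refine sum_le_sum fun t ht => ?_
    have := card_filter_mul_mem_add_translationDefect B t
    have h' : (#{b ∈ B | t * b ∈ B} : ℝ) + translationDefect B t = #B := by exact_mod_cast this
    linarith [hS t ht]
  rw [sum_add_distrib, sum_const, sum_const, nsmul_eq_mul, nsmul_eq_mul] at hle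
  have : (∑ t ∈ S, (#{b ∈ B | t * b ∈ B} : ℝ)) ≤ (#B : ℝ) ^ 2 := by exact_mod_cast hsum
  linarith

/-- If the quotients of a large set almost stabilise `B`, then they generate a finite subgroup of
elements almost stabilising `B`. -/
lemma exists_subgroup_of_translationDefect_le (A B : Finset G) (E : ℝ) (hE : 10 * E ≤ #B)
    (hE0 : 0 < E) (hcard : (4 / 5 : ℝ) * #B ≤ #A)
    (hA : ∀ x ∈ A, ∀ y ∈ A, (translationDefect B (x / y) : ℝ) ≤ E) :
    ∃ (H : Subgroup G) (F : Finset G), (∀ x, x ∈ F ↔ x ∈ H) ∧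
      (∀ x ∈ H, (translationDefect B x : ℝ) ≤ E) ∧ ∀ x ∈ A, ∀ y ∈ A, x / y ∈ H := by
  have hB0 : (0 : ℝ) < #B := by linarith
  obtain ⟨a, ha⟩ : A.Nonempty := by
    rw [← card_pos]
    exact_mod_cast (by linarith : (0 : ℝ) < #A)
  have hgap : ∀ x, (translationDefect B x : ℝ) ≤ 2 * E → (translationDefect B x : ℝ) ≤ E := by
    intro x hx
    by_cases hdisj : Disjoint (A.image (fun y => y / a)) (A.image (fun y => x * (y / a)))
    · exfalso
      have h := card_mul_card_le_of_translationDefect_le B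
        (A.image (fun y => y / a) ∪ A.image (fun y => x * (y / a))) (3 * E) (by
          intro t ht
          rw [mem_union, mem_image, mem_image] at ht
          rcases ht with ⟨y, hy, rfl⟩ | ⟨y, hy, rfl⟩
          · linarith [hA y hy a ha]
          · have h' : (translationDefect B (x * (y / a)) : ℝ) ≤
              translationDefect B x + translationDefect B (y / a) := by
              exact_mod_cast translationDefect_mul_le B x (y / a)
            linarith [hA y hy a ha])
      rw [card_union_of_disjoint hdisj, card_image_of_injective _ (fun u v h => by simpa using h),
        card_image_of_injective _ (fun u v h => by simpa using h)] at h
      push_cast at h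
      nlinarith
    · rw [not_disjoint_iff] at hdisj
      obtain ⟨w, hw, hw'⟩ := hdisj
      rw [mem_image] at hw hw'
      obtain ⟨y, hy, rfl⟩ := hw
      obtain ⟨y', hy', h⟩ := hw'
      have : x = y / y' := by
        rw [← mul_div_assoc, div_left_inj] at h
        rw [← h, mul_div_cancel_right]
      rw [this]
      exact hA y hy y' hy'
  let H : Subgroup G :=
    { carrier := {x | (translationDefect B x : ℝ) ≤ E}
      one_mem' := by simp [translationDefect_one, hE0.le]
      mul_mem' := by
        intro x y hx hy
        refine hgap _ ?_
        have h' : (translationDefect B (x * y) : ℝ) ≤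
            translationDefect B x + translationDefect B y := by
          exact_mod_cast translationDefect_mul_le B x y
        simp only [Set.mem_ofPred_eq] at hx hy
        linarith
      inv_mem' := by
        intro x hx
        simpa [translationDefect_inv] using hx }
  have hmem : ∀ x, x ∈ H ↔ (translationDefect B x : ℝ) ≤ E := fun x => Iff.rfl
  have hfin : (H : Set G).Finite := by
    refine (finite_toSet ((B ×ˢ B).image (fun p => p.1 / p.2))).subset fun x hx => ?_
    have hx' := (hmem x).1 hx
    have hpos : 0 < #{b ∈ B | x * b ∈ B} := by
      have := card_filter_mul_mem_add_translationDefect B x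
      have h' : (#{b ∈ B | x * b ∈ B} : ℝ) + translationDefect B x = #B := by exact_mod_cast this
      exact_mod_cast (by linarith : (0 : ℝ) < #{b ∈ B | x * b ∈ B})
    obtain ⟨b, hb⟩ := card_pos.1 hpos
    rw [mem_filter] at hb
    exact mem_coe.2 (mem_image.2 ⟨(x * b, b), mem_product.2 ⟨hb.2, hb.1⟩, by simp⟩)
  exact ⟨H, hfin.toFinset, by simp, fun x hx => hx, fun x hx y hy => hA x hx y hy⟩

open scoped Classical in
/-- A set almost stabilised by a finite subgroup of comparable size is almost a coset. -/
lemma exists_coset_of_translationDefect_le (B F : Finset G) (H : Subgroup G)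
    (hF : ∀ x, x ∈ F ↔ x ∈ H) (E : ℝ) (hE0 : 0 < E) (hE : 20 * E ≤ #B)
    (hcard : (4 / 5 : ℝ) * #B ≤ #F)
    (hH : ∀ x ∈ H, (translationDefect B x : ℝ) ≤ E) :
    ∃ b, (#{t ∈ F | t * b ∉ B} : ℝ) ≤ 2 * E ∧ (#{x ∈ B | x / b ∉ H} : ℝ) ≤ 2 * E := by
  have hB0 : (0 : ℝ) < #B := by linarith
  have hBne : B.Nonempty := card_pos.1 (by exact_mod_cast hB0)
  have hF2 : (#F : ℝ) ≤ 2 * #B := by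
    have := card_mul_card_le_of_translationDefect_le B F E fun t ht => hH t ((hF t).1 ht)
    by_contra! hlt
    nlinarith
  have hswap : ∑ b ∈ B, #{t ∈ F | t * b ∉ B} = ∑ t ∈ F, translationDefect B t := by
    unfold translationDefect
    simp_rw [card_filter]
    exact sum_comm
  have htot : ∑ b ∈ B, (#{t ∈ F | t * b ∉ B} : ℝ) ≤ #F * E := by
    have h : ∑ t ∈ F, (translationDefect B t : ℝ) ≤ ∑ _t ∈ F, E :=
      sum_le_sum fun t ht => hH t ((hF t).1 ht)
    rw [sum_const, nsmul_eq_mul] at h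
    refine le_trans (le_of_eq ?_) h
    exact_mod_cast hswap
  obtain ⟨b, hb, hbE⟩ : ∃ b ∈ B, (#{t ∈ F | t * b ∉ B} : ℝ) ≤ 2 * E := by
    refine exists_le_of_sum_le hBne (htot.trans ?_)
    rw [sum_const, nsmul_eq_mul]
    nlinarith
  refine ⟨b, hbE, ?_⟩
  set R := #{x ∈ B | x / b ∉ H} with hR
  have hin : (#F : ℝ) - 2 * E ≤ #{x ∈ B | x / b ∈ H} := by
    have h₁ : #{t ∈ F | t * b ∈ B} ≤ #{x ∈ B | x / b ∈ H} := by
      refine card_le_card_of_injOn (fun t => t * b) ?_ (fun _ _ _ _ h => by simpa using h)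
      intro t ht
      simp_all
    have h₂ := card_filter_add_card_filter_not (s := F) (fun t => t * b ∈ B)
    have h₁' : (#{t ∈ F | t * b ∈ B} : ℝ) ≤ #{x ∈ B | x / b ∈ H} := by exact_mod_cast h₁
    have h₂' : (#{t ∈ F | t * b ∈ B} : ℝ) + #{t ∈ F | t * b ∉ B} = #F := by exact_mod_cast h₂
    linarith
  have hRB : (#{x ∈ B | x / b ∈ H} : ℝ) + R = #B := by
    exact_mod_cast card_filter_add_card_filter_not (s := B) (fun x => x / b ∈ H)
  have hRle : (R : ℝ) ≤ #F / 2 := by linarith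
  have hout : ∀ x ∈ ({x ∈ B | x / b ∉ H} : Finset G),
      (#F : ℝ) / 2 ≤ #{t ∈ F | t * x ∉ B} := by
    intro x hx
    have hx' := (mem_filter.1 hx).2
    have h₁ : #{t ∈ F | t * x ∈ B} ≤ R := by
      refine card_le_card_of_injOn (fun t => t * x) ?_ (fun _ _ _ _ h => by simpa using h)
      intro t ht
      simp only [coe_filter, Set.mem_ofPred_eq, hF] at ht ⊢
      refine ⟨ht.2, fun h => hx' ?_⟩
      rw [mul_div_assoc] at h
      exact (H.mul_mem_cancel_left ht.1).1 h
    have h₂ := card_filter_add_card_filter_not (s := F) (fun t => t * x ∈ B)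
    have h₁' : (#{t ∈ F | t * x ∈ B} : ℝ) ≤ R := by exact_mod_cast h₁
    have h₂' : (#{t ∈ F | t * x ∈ B} : ℝ) + #{t ∈ F | t * x ∉ B} = #F := by exact_mod_cast h₂
    linarith
  have hlow : (R : ℝ) * (#F / 2) ≤ #F * E := by
    calc (R : ℝ) * (#F / 2) = ∑ _x ∈ ({x ∈ B | x / b ∉ H} : Finset G), (#F : ℝ) / 2 := by
          rw [sum_const, nsmul_eq_mul]
      _ ≤ ∑ x ∈ ({x ∈ B | x / b ∉ H} : Finset G), (#{t ∈ F | t * x ∉ B} : ℝ) := sum_le_sum hout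
      _ ≤ ∑ x ∈ B, (#{t ∈ F | t * x ∉ B} : ℝ) :=
          sum_le_sum_of_subset_of_nonneg (filter_subset _ _) (fun _ _ _ => Nat.cast_nonneg _)
      _ ≤ #F * E := htot
  have hF0 : (0 : ℝ) < #F := by linarith
  by_contra! hlt
  nlinarith

open scoped Classical in
/-- If most sums of two distinct elements of `A` define reflections almost preserving `B`, then
`A` and `B` are almost cosets of the same finite subgroup, and these cosets differ by an element of
order at most two in the quotient. -/
theorem exists_near_cosets (A B : Finset G) (D : ℝ) (hD : 0 < D) (hbig : 2000 * (D + 1) ≤ #A)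
    (hAB : (#A : ℝ) ≤ #B + D) (hBA : (#B : ℝ) ≤ #A + D)
    (hbad : (∑ p ∈ A.offDiag, (reflectionDefect B (p.1 * p.2) : ℝ)) ≤ D * (#A : ℝ) ^ 2) :
    ∃ (H : Subgroup G) (F : Finset G) (a b : G), (∀ x, x ∈ F ↔ x ∈ H) ∧ (a / b) ^ 2 ∈ H ∧
      2 ≤ #F ∧
      (#{x ∈ A | x / a ∉ H} : ℝ) ≤ 4 * D ∧ (#{t ∈ F | t * a ∉ A} : ℝ) ≤ 85 * D ∧
      (#{x ∈ B | x / b ∉ H} : ℝ) ≤ 80 * D ∧ (#{t ∈ F | t * b ∉ B} : ℝ) ≤ 80 * D := by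
  have hA0 : (0 : ℝ) < #A := by linarith
  have hAne : A.Nonempty := card_pos.1 (by exact_mod_cast hA0)
  set d : G → G → ℝ := fun x y => reflectionDefect B (x * y) with hd
  have hd0 : ∀ x y, 0 ≤ d x y := fun x y => Nat.cast_nonneg _
  obtain ⟨a₀, ha₀, hsum₀⟩ : ∃ x ∈ A, ∑ y ∈ A.erase x, d x y ≤ D * #A := by
    refine exists_le_of_sum_le hAne ?_
    have : ∑ x ∈ A, ∑ y ∈ A.erase x, d x y = ∑ p ∈ A.offDiag, d p.1 p.2 := by
      rw [sum_sigma']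
      refine sum_bij' (fun x _ => (x.1, x.2)) (fun p _ => ⟨p.1, p.2⟩) ?_ ?_ ?_ ?_ ?_
      · rintro ⟨x, y⟩ h
        simp only [mem_sigma, mem_erase, mem_offDiag] at h ⊢
        exact ⟨h.1, h.2.2, h.2.1.symm⟩
      · rintro ⟨x, y⟩ h
        simp only [mem_sigma, mem_erase, mem_offDiag] at h ⊢
        exact ⟨h.1, Ne.symm h.2.2, h.2.1⟩
      · simp
      · simp
      · simp
    rw [this, sum_const, nsmul_eq_mul]
    calc _ ≤ D * (#A : ℝ) ^ 2 := hbad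
      _ = _ := by ring
  set A₀ : Finset G := {y ∈ A.erase a₀ | d a₀ y ≤ 20 * D} with hA₀
  have hA₀sub : A₀ ⊆ A := (filter_subset _ _).trans (erase_subset _ _)
  have hA₀card : (9 / 10 : ℝ) * #A ≤ #A₀ := by
    have h₁ : (#{y ∈ A.erase a₀ | ¬ d a₀ y ≤ 20 * D} : ℝ) * (20 * D) ≤ D * #A := by
      calc _ = ∑ _y ∈ ({y ∈ A.erase a₀ | ¬ d a₀ y ≤ 20 * D} : Finset G), 20 * D := by
            rw [sum_const, nsmul_eq_mul]
        _ ≤ ∑ y ∈ ({y ∈ A.erase a₀ | ¬ d a₀ y ≤ 20 * D} : Finset G), d a₀ y :=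
            sum_le_sum fun y hy => (not_le.1 (mem_filter.1 hy).2).le
        _ ≤ ∑ y ∈ A.erase a₀, d a₀ y :=
            sum_le_sum_of_subset_of_nonneg (filter_subset _ _) (fun _ _ _ => hd0 _ _)
        _ ≤ _ := hsum₀
    have h₂ : (#A₀ : ℝ) + #{y ∈ A.erase a₀ | ¬ d a₀ y ≤ 20 * D} = #(A.erase a₀) := by
      exact_mod_cast card_filter_add_card_filter_not (s := A.erase a₀) (fun y => d a₀ y ≤ 20 * D)
    have h₃ : (#(A.erase a₀) : ℝ) = #A - 1 := by
      rw [card_erase_of_mem ha₀, Nat.cast_sub (card_pos.2 hAne), Nat.cast_one]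
    have h₄ : (#{y ∈ A.erase a₀ | ¬ d a₀ y ≤ 20 * D} : ℝ) ≤ #A / 20 := by
      rw [← not_lt]
      intro hlt
      nlinarith
    linarith
  obtain ⟨H, F, hF, hH, hA₀H⟩ := exists_subgroup_of_translationDefect_le A₀ B (40 * D)
    (by linarith) (by linarith) (by linarith) (by
      intro x hx y hy
      have h := translationDefect_div_le B (a₀ * y) (a₀ * x)
      rw [mul_div_mul_left_eq_div] at h
      have h' : (translationDefect B (x / y) : ℝ) ≤ d a₀ y + d a₀ x := by
        simp only [hd]
        exact_mod_cast h
      linarith [(mem_filter.1 hx).2, (mem_filter.1 hy).2])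
  obtain ⟨a, ha⟩ : A₀.Nonempty := by
    rw [← card_pos]
    exact_mod_cast (by linarith : (0 : ℝ) < #A₀)
  have hFcard : (#A₀ : ℝ) ≤ #F := by
    have : #A₀ ≤ #F := by
      refine card_le_card_of_injOn (fun x => x / a) ?_ (fun _ _ _ _ h => by simpa using h)
      intro x hx
      exact (hF _).2 (hA₀H x hx a ha)
    exact_mod_cast this
  obtain ⟨b, hFb, hBb⟩ := exists_coset_of_translationDefect_le B F H hF (40 * D) (by linarith)
    (by linarith) (by linarith) hH
  have hBin : (#{x ∈ B | x / b ∈ H} : ℝ) + #{x ∈ B | x / b ∉ H} = #B := by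
    exact_mod_cast card_filter_add_card_filter_not (s := B) (fun x => x / b ∈ H)
  have hlarge : ∀ x y, x * y / b ^ 2 ∉ H → (#B : ℝ) / 2 ≤ d x y := by
    intro x y hxy
    have hsub : #{c ∈ B | c / b ∈ H} ≤
        reflectionDefect B (x * y) + #{c ∈ B | c / b ∉ H} := by
      have hs : {c ∈ B | c / b ∈ H} ⊆ {c ∈ B | x * y / c ∉ B} ∪
          ({c ∈ B | c / b ∉ H}).image (fun c => x * y / c) := by
        intro c hc
        rw [mem_filter] at hc
        by_cases hcB : x * y / c ∈ B
        · refine mem_union_right _ (mem_image.2 ⟨_, mem_filter.2 ⟨hcB, fun h => hxy ?_⟩, by simp⟩)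
          have := H.mul_mem h hc.2
          rwa [show x * y / c / b * (c / b) = x * y / b ^ 2 by
            rw [div_mul_div_comm, div_mul_cancel, ← sq]] at this
        · exact mem_union_left _ (mem_filter.2 ⟨hc.1, hcB⟩)
      exact (card_le_card hs).trans ((card_union_le _ _).trans
        (Nat.add_le_add_left card_image_le _))
    have hsub' : (#{c ∈ B | c / b ∈ H} : ℝ) ≤ d x y + #{c ∈ B | c / b ∉ H} := by
      simp only [hd]
      exact_mod_cast hsub
    linarith
  have hcount : ∀ S ⊆ A.offDiag, (∀ p ∈ S, p.1 * p.2 / b ^ 2 ∉ H) →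
      (#S : ℝ) * (#B / 2) ≤ D * (#A : ℝ) ^ 2 := by
    intro S hS hp
    calc (#S : ℝ) * (#B / 2) = ∑ _p ∈ S, (#B / 2 : ℝ) := by rw [sum_const, nsmul_eq_mul]
      _ ≤ ∑ p ∈ S, d p.1 p.2 := sum_le_sum fun p h => hlarge _ _ (hp p h)
      _ ≤ ∑ p ∈ A.offDiag, d p.1 p.2 :=
          sum_le_sum_of_subset_of_nonneg hS fun _ _ _ => hd0 _ _
      _ ≤ _ := hbad
  have hab : (a / b) ^ 2 ∈ H := by
    by_contra hab
    have h := hcount A₀.offDiag (offDiag_mono hA₀sub) (by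
      intro p hp h
      rw [mem_offDiag] at hp
      refine hab ?_
      have h' := H.mul_mem h (H.mul_mem (hA₀H a ha p.1 hp.1) (hA₀H a ha p.2 hp.2.1))
      rwa [show p.1 * p.2 / b ^ 2 * (a / p.1 * (a / p.2)) = (a / b) ^ 2 by
        rw [div_mul_div_comm, ← sq, div_mul_div_comm, mul_comm (b ^ 2), mul_div_mul_left_eq_div,
          div_pow]] at h')
    rw [offDiag_card, Nat.cast_sub (Nat.le_mul_self _)] at h
    push_cast at h
    have hA₀le : (#A₀ : ℝ) ≤ #A := by exact_mod_cast card_le_card hA₀sub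
    have h1 : (1 / 2 : ℝ) * (#A : ℝ) ^ 2 ≤ #A₀ * #A₀ - #A₀ := by nlinarith
    have h2 : (2 : ℝ) * (D + 1) ≤ #B / 2 := by linarith
    nlinarith [sq_nonneg (#A : ℝ), pow_pos hA0 2]
  have hA' : (#{x ∈ A | x / a ∉ H} : ℝ) ≤ 4 * D := by
    have h := hcount ({x ∈ A | x / a ∉ H} ×ˢ A₀) (by
        intro p hp
        rw [mem_product, mem_filter] at hp
        refine mem_offDiag.2 ⟨hp.1.1, hA₀sub hp.2, fun h => hp.1.2 ?_⟩
        rw [h]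
        exact hA₀H _ hp.2 a ha) (by
      intro p hp h
      rw [mem_product, mem_filter] at hp
      refine hp.1.2 ?_
      have h' := H.div_mem (H.mul_mem h (hA₀H a ha p.2 hp.2)) hab
      rwa [show p.1 * p.2 / b ^ 2 * (a / p.2) / (a / b) ^ 2 = p.1 / a by
        rw [div_pow, div_mul_div_comm, mul_right_comm, mul_div_mul_right_eq_div, div_div_div_eq,
          mul_comm (b ^ 2), mul_div_mul_right_eq_div, sq, mul_div_mul_right_eq_div]] at h')
    rw [card_product] at h
    push_cast at h
    by_contra! hlt
    have h1 : (9 / 10 : ℝ) * #A * ((999 / 1000) * #A / 2) ≤ #A₀ * (#B / 2) := by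
      apply mul_le_mul hA₀card _ (by positivity) (by positivity)
      linarith
    nlinarith [pow_pos hA0 2]
  refine ⟨H, F, a, b, hF, hab, ?_, hA', ?_, by linarith, by linarith⟩
  · exact_mod_cast (by linarith : (2 : ℝ) ≤ #F)
  · have h₁ : (#{x ∈ A | x / a ∈ H} : ℝ) + #{x ∈ A | x / a ∉ H} = #A := by
      exact_mod_cast card_filter_add_card_filter_not (s := A) (fun x => x / a ∈ H)
    have h₂ : (#{t ∈ F | t * a ∈ A} : ℝ) + #{t ∈ F | t * a ∉ A} = #F := by
      exact_mod_cast card_filter_add_card_filter_not (s := F) (fun t => t * a ∈ A)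
    have h₃ : (#{t ∈ F | t * b ∈ B} : ℝ) + #{t ∈ F | t * b ∉ B} = #F := by
      exact_mod_cast card_filter_add_card_filter_not (s := F) (fun t => t * b ∈ B)
    have h₄ : (#{t ∈ F | t * b ∈ B} : ℝ) ≤ #B := by
      have : #{t ∈ F | t * b ∈ B} ≤ #B :=
        card_le_card_of_injOn (fun t => t * b) (fun t ht => (mem_filter.1 ht).2)
          (fun _ _ _ _ h => by simpa using h)
      exact_mod_cast this
    have h₅ : (#{x ∈ A | x / a ∈ H} : ℝ) ≤ #{t ∈ F | t * a ∈ A} := by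
      have : #{x ∈ A | x / a ∈ H} ≤ #{t ∈ F | t * a ∈ A} := by
        refine card_le_card_of_injOn (fun x => x / a) ?_ (fun _ _ _ _ h => by simpa using h)
        intro x hx
        simp_all
      exact_mod_cast this
    linarith

end NearCoset

section GenCircle

open ComplexConjugate

lemma IsGenCircle.exists_equation {C : Set ℂ} (hC : IsGenCircle C) (z : ℂ) :
    ∃ p a b d : ℝ, (p ≠ 0 ∨ a ≠ 0 ∨ b ≠ 0) ∧ ∀ w : ℂ, z + w ∈ C ↔
      p * (w.re ^ 2 + w.im ^ 2) + a * w.re + b * w.im + d = 0 := by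
  rcases hC with ⟨c, ρ, hρ, rfl⟩ | ⟨c, v, hv, rfl⟩
  · refine ⟨1, 2 * (z - c).re, 2 * (z - c).im, (z - c).re ^ 2 + (z - c).im ^ 2 - ρ ^ 2,
      Or.inl one_ne_zero, fun w => ?_⟩
    rw [mem_sphere_iff_norm, ← sq_eq_sq₀ (norm_nonneg _) hρ.le, ← Complex.normSq_eq_norm_sq,
      Complex.normSq_apply]
    simp only [Complex.sub_re, Complex.add_re, Complex.sub_im, Complex.add_im]
    constructor <;> intro h <;> linear_combination h
  · refine ⟨0, v.im, -v.re, (z - c).re * v.im - (z - c).im * v.re, Or.inr ?_, fun w => ?_⟩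
    · by_contra! h
      exact hv (Complex.ext (by simpa using h.2) (by simpa using h.1))
    · constructor
      · rintro ⟨t, ht⟩
        have h₁ := congrArg Complex.re ht
        have h₂ := congrArg Complex.im ht
        simp at h₁ h₂ ⊢
        linear_combination v.im * h₁ - v.re * h₂
      · intro h
        have hv' : v.re ^ 2 + v.im ^ 2 ≠ 0 := by
          intro h0
          exact hv (Complex.ext (by simp; nlinarith) (by simp; nlinarith))
        obtain ⟨t, ht⟩ : ∃ t : ℝ, t * (v.re ^ 2 + v.im ^ 2) =
            (z.re + w.re - c.re) * v.re + (z.im + w.im - c.im) * v.im :=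
          ⟨_, div_mul_cancel₀ _ hv'⟩
        simp only [Complex.sub_re, Complex.sub_im] at h
        refine ⟨t, Complex.ext (mul_left_cancel₀ hv' ?_) (mul_left_cancel₀ hv' ?_)⟩
        · simp only [Complex.add_re, Complex.real_smul, Complex.re_ofReal_mul]
          linear_combination v.im * h - v.re * ht
        · simp only [Complex.add_im, Complex.real_smul, Complex.im_ofReal_mul]
          linear_combination -v.re * h - v.im * ht

lemma isGenCircle_of_equation {C : Set ℂ} {z : ℂ} {p a b d : ℝ} (h0 : p ≠ 0 ∨ a ≠ 0 ∨ b ≠ 0)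
    (hC : ∀ w : ℂ, z + w ∈ C ↔ p * (w.re ^ 2 + w.im ^ 2) + a * w.re + b * w.im + d = 0)
    {x y : ℂ} (hx : z + x ∈ C) (hy : z + y ∈ C) (hxy : x ≠ y) : IsGenCircle C := by
  have hC' : ∀ w : ℂ, w ∈ C ↔ p * ((w - z).re ^ 2 + (w - z).im ^ 2) + a * (w - z).re +
      b * (w - z).im + d = 0 := by
    intro w
    rw [← hC, add_sub_cancel]
  rw [hC] at hx hy
  by_cases hp : p = 0
  · subst hp
    have hab : a ^ 2 + b ^ 2 ≠ 0 := by
      intro h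
      rcases h0 with h0 | h0 | h0
      · exact h0 rfl
      · exact h0 (by nlinarith)
      · exact h0 (by nlinarith)
    refine Or.inr ⟨z + x, ⟨-b, a⟩, ?_, ?_⟩
    · intro h
      have h₁ := congrArg Complex.re h
      have h₂ := congrArg Complex.im h
      simp at h₁ h₂
      simp [h₁, h₂] at hab
    · ext w
      rw [hC']
      constructor
      · intro h
        obtain ⟨t, ht⟩ : ∃ t : ℝ, t * (a ^ 2 + b ^ 2) =
            (w.re - z.re - x.re) * (-b) + (w.im - z.im - x.im) * a :=
          ⟨_, div_mul_cancel₀ _ hab⟩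
        simp only [Complex.sub_re, Complex.sub_im] at h
        refine ⟨t, Complex.ext (mul_left_cancel₀ hab ?_) (mul_left_cancel₀ hab ?_)⟩
        · simp only [Complex.add_re, Complex.real_smul, Complex.re_ofReal_mul]
          linear_combination a * h - a * hx + b * ht
        · simp only [Complex.add_im, Complex.real_smul, Complex.im_ofReal_mul]
          linear_combination b * h - b * hx - a * ht
      · rintro ⟨t, rfl⟩
        simp
        linear_combination hx
  · have hpos : 0 < (a ^ 2 + b ^ 2) / (4 * p ^ 2) - d / p := by
      have hform : ∀ w : ℂ, p * (w.re ^ 2 + w.im ^ 2) + a * w.re + b * w.im + d = 0 →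
          (a ^ 2 + b ^ 2) / (4 * p ^ 2) - d / p =
            (w.re + a / (2 * p)) ^ 2 + (w.im + b / (2 * p)) ^ 2 := by
        intro w hw
        field_simp
        linear_combination -16 * p * hw
      by_contra! hle
      refine hxy (Complex.ext ?_ ?_)
      · have h₁ := hform x hx
        have h₂ := hform y hy
        have e₁ : x.re + a / (2 * p) = 0 := by nlinarith
        have e₂ : y.re + a / (2 * p) = 0 := by nlinarith
        linarith
      · have h₁ := hform x hx
        have h₂ := hform y hy
        have e₁ : x.im + b / (2 * p) = 0 := by nlinarith
        have e₂ : y.im + b / (2 * p) = 0 := by nlinarith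
        linarith
    refine Or.inl ⟨⟨z.re - a / (2 * p), z.im - b / (2 * p)⟩, _, Real.sqrt_pos.2 hpos, ?_⟩
    ext w
    rw [hC', mem_sphere_iff_norm, ← sq_eq_sq₀ (norm_nonneg _) (Real.sqrt_nonneg _),
      ← Complex.normSq_eq_norm_sq, Complex.normSq_apply, Real.sq_sqrt hpos.le]
    simp only [Complex.sub_re, Complex.sub_im]
    field_simp
    constructor <;> intro h
    · linear_combination 16 * p * h
    · have : 16 * p * (p * ((w.re - z.re) ^ 2 + (w.im - z.im) ^ 2) + a * (w.re - z.re) +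
          b * (w.im - z.im) + d) = 0 := by linear_combination h
      have h4 : (16 * p) ≠ 0 := by positivity
      have := (mul_eq_zero.1 this).resolve_left h4
      linear_combination this

/-- A generalised circle is determined by three of its points. -/
lemma IsGenCircle.mem_iff {C : Set ℂ} (hC : IsGenCircle C) {z x y : ℂ} (hz : z ∈ C)
    (hx : z + x ∈ C) (hy : z + y ∈ C) (hx0 : x ≠ 0) (hy0 : y ≠ 0) (hxy : x ≠ y) (w : ℂ) :
    z + w ∈ C ↔ (w.re ^ 2 + w.im ^ 2) * (x.re * y.im - x.im * y.re) +
      w.re * (x.im * (y.re ^ 2 + y.im ^ 2) - (x.re ^ 2 + x.im ^ 2) * y.im) +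
      w.im * ((x.re ^ 2 + x.im ^ 2) * y.re - x.re * (y.re ^ 2 + y.im ^ 2)) = 0 := by
  obtain ⟨p, a, b, d, h0, hC⟩ := hC.exists_equation z
  have hz' := (hC 0).1 (by simpa using hz)
  have hd : d = 0 := by simpa using hz'
  subst hd
  rw [hC] at hx hy ⊢
  set N₁ := x.re * y.im - x.im * y.re with hN₁
  set N₂ := x.im * (y.re ^ 2 + y.im ^ 2) - (x.re ^ 2 + x.im ^ 2) * y.im with hN₂
  set N₃ := (x.re ^ 2 + x.im ^ 2) * y.re - x.re * (y.re ^ 2 + y.im ^ 2) with hN₃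
  have e₁ : p * N₂ = a * N₁ := by
    rw [hN₁, hN₂]; linear_combination x.im * hy - y.im * hx
  have e₂ : p * N₃ = b * N₁ := by
    rw [hN₁, hN₃]; linear_combination y.re * hx - x.re * hy
  have e₃ : a * N₃ = b * N₂ := by
    rw [hN₂, hN₃]
    linear_combination (x.re ^ 2 + x.im ^ 2) * hy - (y.re ^ 2 + y.im ^ 2) * hx
  have hN : N₁ ≠ 0 ∨ N₂ ≠ 0 ∨ N₃ ≠ 0 := by
    by_contra! h
    obtain ⟨h₁, h₂, h₃⟩ := h
    have hX : 0 < x.re ^ 2 + x.im ^ 2 := by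
      have := Complex.normSq_pos.2 hx0
      rw [Complex.normSq_apply] at this
      linarith
    have hY : 0 < y.re ^ 2 + y.im ^ 2 := by
      have := Complex.normSq_pos.2 hy0
      rw [Complex.normSq_apply] at this
      linarith
    set X := x.re ^ 2 + x.im ^ 2 with hXdef
    set Y := y.re ^ 2 + y.im ^ 2 with hYdef
    have hXY : X = Y := by
      have h4 : X * Y * (X - Y) = 0 := by
        have h5 : X * y.im = Y * x.im := by linarith
        have h6 : X * y.re = Y * x.re := by linarith
        have h7 : X ^ 2 * Y = Y ^ 2 * X := by
          have e5 : (X * y.im) ^ 2 = (Y * x.im) ^ 2 := by rw [h5]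
          have e6 : (X * y.re) ^ 2 = (Y * x.re) ^ 2 := by rw [h6]
          calc X ^ 2 * Y = (X * y.re) ^ 2 + (X * y.im) ^ 2 := by rw [hYdef]; ring
            _ = (Y * x.re) ^ 2 + (Y * x.im) ^ 2 := by rw [e5, e6]
            _ = Y ^ 2 * X := by rw [hXdef]; ring
        linear_combination h7
      have := (mul_eq_zero.1 h4).resolve_left (by positivity)
      linarith
    rw [hN₂, ← hXY] at h₂
    rw [hN₃, ← hXY] at h₃
    refine hxy (Complex.ext ?_ ?_)
    · have : X * (y.re - x.re) = 0 := by linarith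
      have := (mul_eq_zero.1 this).resolve_left hX.ne'
      linarith
    · have : X * (x.im - y.im) = 0 := by linarith
      have := (mul_eq_zero.1 this).resolve_left hX.ne'
      linarith
  set W := w.re ^ 2 + w.im ^ 2 with hW
  constructor
  · intro h
    rcases h0 with h0 | h0 | h0
    · refine (mul_eq_zero.1 (?_ : p * _ = 0)).resolve_left h0
      linear_combination N₁ * h + w.re * e₁ + w.im * e₂
    · refine (mul_eq_zero.1 (?_ : a * _ = 0)).resolve_left h0
      linear_combination N₂ * h - W * e₁ + w.im * e₃
    · refine (mul_eq_zero.1 (?_ : b * _ = 0)).resolve_left h0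
      linear_combination N₃ * h - W * e₂ - w.re * e₃
  · intro h
    rcases hN with hN | hN | hN
    · refine (mul_eq_zero.1 (?_ : N₁ * _ = 0)).resolve_left hN
      linear_combination p * h - w.re * e₁ - w.im * e₂
    · refine (mul_eq_zero.1 (?_ : N₂ * _ = 0)).resolve_left hN
      linear_combination a * h + W * e₁ - w.im * e₃
    · refine (mul_eq_zero.1 (?_ : N₃ * _ = 0)).resolve_left hN
      linear_combination b * h + W * e₂ + w.re * e₃

lemma IsGenCircle.eq_of_mem {C C' : Set ℂ} (hC : IsGenCircle C) (hC' : IsGenCircle C') {x y z : ℂ}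
    (hxy : x ≠ y) (hxz : x ≠ z) (hyz : y ≠ z) (hx : x ∈ C) (hy : y ∈ C) (hz : z ∈ C)
    (hx' : x ∈ C') (hy' : y ∈ C') (hz' : z ∈ C') : C = C' := by
  ext w
  have h := hC.mem_iff hx (x := y - x) (y := z - x) (by simpa) (by simpa)
    (sub_ne_zero.2 hxy.symm) (sub_ne_zero.2 hxz.symm) (by simpa using hyz) (w - x)
  have h' := hC'.mem_iff hx' (x := y - x) (y := z - x) (by simpa) (by simpa)
    (sub_ne_zero.2 hxy.symm) (sub_ne_zero.2 hxz.symm) (by simpa using hyz) (w - x)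
  rw [add_sub_cancel] at h h'
  rw [h, h']

/-- A generalised circle meeting two different circles centred at `z` meets each circle centred
at `z` in at most two points, and the product of their directions is always the same. -/
lemma IsGenCircle.exists_mul_eq {C : Set ℂ} (hC : IsGenCircle C) {z : ℂ} {r₁ r₂ : ℝ} (h₁ : 0 < r₁)
    (h₂ : 0 < r₂) (hr : r₁ ≠ r₂) {u v : Circle} (hu : z + r₁ * u ∈ C) (hv : z + r₂ * v ∈ C) :
    ∃ s : ℂ, ∀ ρ : ℝ, 0 < ρ → ∀ x y : Circle, x ≠ y → z + ρ * x ∈ C → z + ρ * y ∈ C →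
      (x * y : ℂ) = s := by
  obtain ⟨p, a, b, d, h0, hC⟩ := hC.exists_equation z
  have hunit : ∀ x : Circle, (x : ℂ).re ^ 2 + (x : ℂ).im ^ 2 = 1 := by
    intro x
    have := Circle.normSq_coe x
    rw [Complex.normSq_apply] at this
    linarith
  have heq : ∀ (ρ : ℝ) (x : Circle), z + ρ * x ∈ C ↔
      p * ρ ^ 2 + d + ρ * (a * (x : ℂ).re + b * (x : ℂ).im) = 0 := by
    intro ρ x
    rw [hC]
    simp only [Complex.re_ofReal_mul, Complex.im_ofReal_mul]
    constructor <;> intro h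
    · linear_combination h - p * ρ ^ 2 * hunit x
    · linear_combination h + p * ρ ^ 2 * hunit x
  set q : ℂ := ⟨a, b⟩ with hq
  have hq0 : q ≠ 0 := by
    intro h
    have ha : a = 0 := congrArg Complex.re h
    have hb : b = 0 := congrArg Complex.im h
    rw [heq] at hu hv
    have hp : p * (r₁ ^ 2 - r₂ ^ 2) = 0 := by
      rw [ha, hb] at hu hv
      linear_combination hu - hv
    have hr' : r₁ ^ 2 - r₂ ^ 2 ≠ 0 := by
      rw [sub_ne_zero]
      exact fun h => hr ((sq_eq_sq₀ h₁.le h₂.le).1 h)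
    have hp0 := (mul_eq_zero.1 hp).resolve_right hr'
    simp [ha, hb, hp0] at h0
  have hq0' : conj q ≠ 0 := by simpa using hq0
  refine ⟨q / conj q, fun ρ hρ x y hxy hx hy => ?_⟩
  rw [heq] at hx hy
  have hquad : ∀ x : Circle, p * ρ ^ 2 + d + ρ * (a * (x : ℂ).re + b * (x : ℂ).im) = 0 →
      conj q * ρ * (x : ℂ) ^ 2 + 2 * (p * ρ ^ 2 + d) * x + q * ρ = 0 := by
    intro x hx
    have hu := hunit x
    apply Complex.ext
    · simp [hq, pow_two]
      linear_combination 2 * (x : ℂ).re * hx - ρ * a * hu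
    · simp [hq, pow_two]
      linear_combination 2 * (x : ℂ).im * hx - ρ * b * hu
  have hx' := hquad x hx
  have hy' := hquad y hy
  have hne : (x : ℂ) - y ≠ 0 := sub_ne_zero.2 fun h => hxy (Circle.ext h)
  have hρ' : (ρ : ℂ) ≠ 0 := by exact_mod_cast hρ.ne'
  rw [eq_div_iff hq0']
  refine mul_left_cancel₀ (mul_ne_zero hne hρ') ?_
  linear_combination (y : ℂ) * hx' - (x : ℂ) * hy'

lemma exists_isGenCircle_mem (z : ℂ) {r₁ r₂ : ℝ} (h₁ : 0 < r₁) (h₂ : 0 < r₂) (hr : r₁ ≠ r₂)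
    (u u' v : Circle) : ∃ C : Set ℂ, IsGenCircle C ∧ z + r₁ * u ∈ C ∧ z + r₁ * u' ∈ C ∧
      z + r₂ * v ∈ C := by
  have hunit : ∀ x : Circle, (x : ℂ).re ^ 2 + (x : ℂ).im ^ 2 = 1 := by
    intro x
    have := Circle.normSq_coe x
    rw [Complex.normSq_apply] at this
    linarith
  have hr' : r₁ ^ 2 - r₂ ^ 2 ≠ 0 := by
    rw [sub_ne_zero]
    exact fun h => hr ((sq_eq_sq₀ h₁.le h₂.le).1 h)
  obtain ⟨a, b, hab, huu'⟩ : ∃ a b : ℝ, (a ≠ 0 ∨ b ≠ 0) ∧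
      a * (u : ℂ).re + b * (u : ℂ).im = a * (u' : ℂ).re + b * (u' : ℂ).im := by
    by_cases h : (u : ℂ).re + (u' : ℂ).re ≠ 0 ∨ (u : ℂ).im + (u' : ℂ).im ≠ 0
    · exact ⟨_, _, h, by linear_combination hunit u - hunit u'⟩
    · push Not at h
      refine ⟨-(u : ℂ).im, (u : ℂ).re, ?_, ?_⟩
      · by_contra! h'
        have := hunit u
        rw [h'.2, neg_eq_zero.1 h'.1] at this
        norm_num at this
      · linear_combination (u : ℂ).im * h.1 - (u : ℂ).re * h.2
  set p := -(r₁ * (a * (u : ℂ).re + b * (u : ℂ).im) - r₂ * (a * (v : ℂ).re + b * (v : ℂ).im)) /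
    (r₁ ^ 2 - r₂ ^ 2) with hp
  set d := -(p * r₁ ^ 2) - r₁ * (a * (u : ℂ).re + b * (u : ℂ).im) with hd
  have hp' : p * (r₁ ^ 2 - r₂ ^ 2) =
      -(r₁ * (a * (u : ℂ).re + b * (u : ℂ).im) - r₂ * (a * (v : ℂ).re + b * (v : ℂ).im)) :=
    div_mul_cancel₀ _ hr'
  have hmem : ∀ w : ℂ, z + w ∈ {x : ℂ | p * ((x - z).re ^ 2 + (x - z).im ^ 2) + a * (x - z).re +
      b * (x - z).im + d = 0} ↔ p * (w.re ^ 2 + w.im ^ 2) + a * w.re + b * w.im + d = 0 := by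
    intro w
    simp
  have hu : p * ((r₁ * u : ℂ).re ^ 2 + (r₁ * u : ℂ).im ^ 2) + a * (r₁ * u : ℂ).re +
      b * (r₁ * u : ℂ).im + d = 0 := by
    simp only [Complex.re_ofReal_mul, Complex.im_ofReal_mul]
    linear_combination p * r₁ ^ 2 * hunit u + hd
  have hu' : p * ((r₁ * u' : ℂ).re ^ 2 + (r₁ * u' : ℂ).im ^ 2) + a * (r₁ * u' : ℂ).re +
      b * (r₁ * u' : ℂ).im + d = 0 := by
    simp only [Complex.re_ofReal_mul, Complex.im_ofReal_mul]
    linear_combination p * r₁ ^ 2 * hunit u' + hd - r₁ * huu'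
  have hv : p * ((r₂ * v : ℂ).re ^ 2 + (r₂ * v : ℂ).im ^ 2) + a * (r₂ * v : ℂ).re +
      b * (r₂ * v : ℂ).im + d = 0 := by
    simp only [Complex.re_ofReal_mul, Complex.im_ofReal_mul]
    linear_combination p * r₂ ^ 2 * hunit v + hd - hp'
  refine ⟨_, isGenCircle_of_equation (Or.inr hab) hmem ((hmem _).2 hu) ((hmem _).2 hv) ?_,
    (hmem _).2 hu, (hmem _).2 hu', (hmem _).2 hv⟩
  intro h
  have := congrArg norm h
  simp only [norm_mul, Circle.norm_coe, mul_one, Complex.norm_real, Real.norm_of_nonneg h₁.le,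
    Real.norm_of_nonneg h₂.le] at this
  exact hr this

end GenCircle

section Polygon

lemma setOf_exists_exp_eq {m : ℕ} (hm : m ≠ 0) :
    {z : ℂ | ∃ k : ℕ, k < m ∧
      z = Complex.exp (((2 * Real.pi * (k : ℝ) / (m : ℝ) : ℝ) : ℂ) * Complex.I)} =
    {z | z ^ m = 1} := by
  have hexp : ∀ k : ℕ, Complex.exp (((2 * Real.pi * (k : ℝ) / (m : ℝ) : ℝ) : ℂ) * Complex.I) =
      Complex.exp (2 * Real.pi * Complex.I / m) ^ k := by
    intro k
    rw [← Complex.exp_nat_mul]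
    congr 1
    push_cast
    ring
  have hprim := Complex.isPrimitiveRoot_exp m hm
  have : NeZero m := ⟨hm⟩
  ext z
  simp only [Set.mem_ofPred_eq, hexp]
  constructor
  · rintro ⟨k, -, rfl⟩
    rw [pow_right_comm, hprim.pow_eq_one, one_pow]
  · intro hz
    obtain ⟨k, hk, h⟩ := hprim.eq_pow_of_pow_eq_one hz
    exact ⟨k, hk, h.symm⟩

lemma alignedDoublePolygon_eq {m : ℕ} (hm : m ≠ 0) (r : ℝ) :
    alignedDoublePolygon m r = {z | z ^ m = 1} ∪ (fun z : ℂ => r * z) '' {z | z ^ m = 1} := by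
  rw [alignedDoublePolygon, ← setOf_exists_exp_eq hm]
  congr 1
  ext z
  constructor
  · rintro ⟨k, hk, rfl⟩
    exact ⟨_, ⟨k, hk, rfl⟩, rfl⟩
  · rintro ⟨_, ⟨k, hk, rfl⟩, rfl⟩
    exact ⟨k, hk, rfl⟩

lemma offsetDoublePolygon_eq {m : ℕ} (hm : m ≠ 0) (r : ℝ) :
    offsetDoublePolygon m r = {z | z ^ m = 1} ∪ (fun z : ℂ => r * z) '' {z | z ^ m = -1} := by
  set ω := Complex.exp (Real.pi / m * Complex.I) with hω
  have hω0 : ω ≠ 0 := Complex.exp_ne_zero _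
  have hωm : ω ^ m = -1 := by
    rw [hω, ← Complex.exp_nat_mul, ← Complex.exp_pi_mul_I]
    congr 1
    field_simp
  have hexp : ∀ k : ℕ,
      Complex.exp (((Real.pi * (2 * (k : ℝ) + 1) / (m : ℝ) : ℝ) : ℂ) * Complex.I) =
      ω * Complex.exp (((2 * Real.pi * (k : ℝ) / (m : ℝ) : ℝ) : ℂ) * Complex.I) := by
    intro k
    rw [hω, ← Complex.exp_add]
    congr 1
    push_cast
    ring
  rw [offsetDoublePolygon, setOf_exists_exp_eq hm]
  congr 1
  ext z
  simp only [hexp]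
  constructor
  · rintro ⟨k, hk, rfl⟩
    refine ⟨_, ?_, rfl⟩
    have h : Complex.exp (((2 * Real.pi * (k : ℝ) / (m : ℝ) : ℝ) : ℂ) * Complex.I) ∈
        {z : ℂ | z ^ m = 1} := by
      rw [← setOf_exists_exp_eq hm]
      exact ⟨k, hk, rfl⟩
    rw [Set.mem_ofPred_eq] at h ⊢
    rw [mul_pow, h, hωm, mul_one]
  · rintro ⟨ζ, hζ, rfl⟩
    have h : ζ / ω ∈ {z : ℂ | z ^ m = 1} := by
      rw [Set.mem_ofPred_eq] at hζ ⊢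
      rw [div_pow, hζ, hωm, div_self (by norm_num)]
    rw [← setOf_exists_exp_eq hm] at h
    obtain ⟨k, hk, h⟩ := h
    exact ⟨k, hk, by rw [← h, mul_div_cancel₀ _ hω0]⟩

/-- A finite subgroup of the circle consists of roots of unity. -/
lemma Circle.mem_subgroup_iff_pow_eq_one {H : Subgroup Circle} {F : Finset Circle}
    (hF : ∀ x, x ∈ F ↔ x ∈ H) (x : Circle) : x ∈ H ↔ (x : ℂ) ^ F.card = 1 := by
  classical
  have hcard : Nat.card H = F.card := by
    rw [← Nat.card_eq_finsetCard]
    exact Nat.card_congr (Equiv.subtypeEquivRight fun x => (hF x).symm)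
  have hpos : 0 < F.card := Finset.card_pos.2 ⟨1, (hF 1).2 H.one_mem⟩
  have hpow : ∀ y ∈ H, (y : ℂ) ^ F.card = 1 := by
    intro y hy
    rw [← hcard]
    have h : y ^ Nat.card H = 1 := congrArg Subtype.val (pow_card_eq_one' (x := (⟨y, hy⟩ : H)))
    rw [← Circle.coe_pow, h, Circle.coe_one]
  refine ⟨hpow x, fun hx => ?_⟩
  have hsub : F.image (fun y : Circle => (y : ℂ)) ⊆ Polynomial.nthRootsFinset F.card (1 : ℂ) := by
    intro w hw
    obtain ⟨y, hy, rfl⟩ := Finset.mem_image.1 hw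
    exact (Polynomial.mem_nthRootsFinset hpos 1).2 (hpow y ((hF y).1 hy))
  have heq := Finset.eq_of_subset_of_card_le hsub
    ((Complex.isPrimitiveRoot_exp _ hpos.ne').card_nthRootsFinset.le.trans
      (Finset.card_image_of_injective F Circle.coe_injective).ge)
  have hx' : (x : ℂ) ∈ F.image (fun y : Circle => (y : ℂ)) := by
    rw [heq]
    exact (Polynomial.mem_nthRootsFinset hpos 1).2 hx
  obtain ⟨y, hy, hyx⟩ := Finset.mem_image.1 hx'
  rw [← Circle.ext hyx]
  exact (hF y).1 hy

end Polygon

section Counting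

open Finset

lemma finite_setOf_isGenCircle_ncard_eq_three (P : Finset ℂ) :
    {C : Set ℂ | IsGenCircle C ∧ (C ∩ P).ncard = 3}.Finite := by
  refine Set.Finite.of_finite_image (f := fun C => C ∩ (P : Set ℂ))
    (P.finite_toSet.finite_subsets.subset ?_) ?_
  · rintro _ ⟨C, -, rfl⟩
    exact Set.inter_subset_right
  · rintro C ⟨hC, h3⟩ C' ⟨hC', -⟩ h
    dsimp only at h
    obtain ⟨x, y, w, hxy, hxw, hyw, hxyw⟩ := Set.ncard_eq_three.1 h3
    have hmem : ∀ t ∈ ({x, y, w} : Set ℂ), t ∈ C ∧ t ∈ C' := by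
      intro t ht
      rw [← hxyw] at ht
      exact ⟨ht.1, (h ▸ ht : t ∈ C' ∩ P).1⟩
    have hx := hmem x (by simp)
    have hy := hmem y (by simp)
    have hw := hmem w (by simp)
    exact hC.eq_of_mem hC' hxy hxw hyw hx.1 hy.1 hw.1 hx.2 hy.2 hw.2

lemma mem_sphere_iff_exists_circle {z w : ℂ} {r : ℝ} (hr : 0 < r) :
    w ∈ Metric.sphere z r ↔ ∃ u : Circle, z + r * u = w := by
  have hr' : (r : ℂ) ≠ 0 := by exact_mod_cast hr.ne'
  constructor
  · intro h
    rw [mem_sphere_iff_norm] at h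
    refine ⟨⟨(w - z) / r, ?_⟩, ?_⟩
    · rw [Submonoid.unitSphere, ← SetLike.mem_coe]
      simp [h, abs_of_pos hr, hr.ne']
    · simp only
      rw [mul_div_cancel₀ _ hr', add_sub_cancel]
  · rintro ⟨u, rfl⟩
    rw [mem_sphere_iff_norm, add_sub_cancel_left, norm_mul, Circle.norm_coe, mul_one,
      Complex.norm_real, Real.norm_of_nonneg hr.le]

lemma add_mul_circle_injective (z : ℂ) {r : ℝ} (hr : 0 < r) :
    Function.Injective (fun u : Circle => z + r * (u : ℂ)) := by
  intro u v h
  have hr' : (r : ℂ) ≠ 0 := by exact_mod_cast hr.ne'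
  exact Circle.ext (mul_left_cancel₀ hr' (add_left_cancel h))

lemma add_mul_circle_ne (z : ℂ) {r₁ r₂ : ℝ} (h₁ : 0 < r₁) (h₂ : 0 < r₂) (hr : r₁ ≠ r₂)
    (u v : Circle) : z + r₁ * u ≠ z + r₂ * v := by
  intro h
  have := congrArg norm (add_left_cancel h)
  simp only [norm_mul, Circle.norm_coe, mul_one, Complex.norm_real, Real.norm_of_nonneg h₁.le,
    Real.norm_of_nonneg h₂.le] at this
  exact hr this

open scoped Classical in
/-- The sum of the reflection defects counts circles which are ordinary or pass through a point
off the two concentric circles. -/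
lemma sum_reflectionDefect_le (P : Finset ℂ) (z : ℂ) {r₁ r₂ : ℝ} (h₁ : 0 < r₁) (h₂ : 0 < r₂)
    (hr : r₁ ≠ r₂) (A B : Finset Circle) (S : Finset ℂ)
    (hA : ∀ u : Circle, u ∈ A ↔ z + r₁ * u ∈ P) (hB : ∀ u : Circle, u ∈ B ↔ z + r₂ * u ∈ P)
    (hS : ∀ w, w ∈ S ↔ w ∈ P ∧ w ∉ Metric.sphere z r₁ ∪ Metric.sphere z r₂) :
    ∑ p ∈ A.offDiag, reflectionDefect B (p.1 * p.2) ≤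
      2 * ordinaryGenCircles (P : Set ℂ) + 2 * (#S * #A ^ 2) := by
  choose C hC hCu hCu' hCv using fun u u' v : Circle =>
    exists_isGenCircle_mem z h₁ h₂ hr u u' v
  set Q : Finset ((Circle × Circle) × Circle) :=
    {q ∈ A.offDiag ×ˢ B | q.1.1 * q.1.2 / q.2 ∉ B} with hQ
  have hsum : ∑ p ∈ A.offDiag, reflectionDefect B (p.1 * p.2) = #Q := by
    rw [hQ, card_filter, sum_product]
    refine sum_congr rfl fun p _ => ?_
    rw [reflectionDefect, card_filter]
  have hQmem : ∀ q ∈ Q, q.1.1 ∈ A ∧ q.1.2 ∈ A ∧ q.1.1 ≠ q.1.2 ∧ q.2 ∈ B ∧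
      q.1.1 * q.1.2 / q.2 ∉ B := by
    intro q hq
    rw [hQ, mem_filter, mem_product, mem_offDiag] at hq
    exact ⟨hq.1.1.1, hq.1.1.2.1, hq.1.1.2.2, hq.1.2, hq.2⟩
  have hmem₁ : ∀ u u' v w : Circle, u ≠ u' → z + r₁ * w ∈ C u u' v → w = u ∨ w = u' := by
    intro u u' v w huu' hw
    obtain ⟨s, hs⟩ := (hC u u' v).exists_mul_eq h₁ h₂ hr (hCu u u' v) (hCv u u' v)
    by_contra! h
    have e := (hs r₁ h₁ u w h.1.symm (hCu u u' v) hw).trans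
      (hs r₁ h₁ u u' huu' (hCu u u' v) (hCu' u u' v)).symm
    exact h.2 (Circle.ext (mul_left_cancel₀ (Circle.coe_ne_zero u) e))
  have hmem₂ : ∀ u u' v w : Circle, u ≠ u' → z + r₂ * w ∈ C u u' v → w = v ∨ w = u * u' / v := by
    intro u u' v w huu' hw
    obtain ⟨s, hs⟩ := (hC u u' v).exists_mul_eq h₁ h₂ hr (hCu u u' v) (hCv u u' v)
    by_contra! h
    have e := (hs r₂ h₂ w v h.1 hw (hCv u u' v)).trans
      (hs r₁ h₁ u u' huu' (hCu u u' v) (hCu' u u' v)).symm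
    exact h.2 (eq_div_of_mul_eq' (Circle.ext (by simpa using e)))
  set Q₁ := {q ∈ Q | ∃ s ∈ S, s ∈ C q.1.1 q.1.2 q.2} with hQ₁
  set Q₂ := {q ∈ Q | ¬ ∃ s ∈ S, s ∈ C q.1.1 q.1.2 q.2} with hQ₂
  have hsplit : #Q₁ + #Q₂ = #Q := card_filter_add_card_filter_not _
  have hcard₁ : #Q₁ ≤ #S * #A ^ 2 * 2 := by
    have hsub : Q₁ ⊆ (S ×ˢ A.offDiag).biUnion fun x =>
        ({c ∈ B | x.1 ∈ C x.2.1 x.2.2 c} : Finset Circle).image fun c => (x.2, c) := by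
      intro q hq
      rw [hQ₁, mem_filter] at hq
      obtain ⟨hq, s, hs, hsC⟩ := hq
      have hq' := hQmem q hq
      refine mem_biUnion.2 ⟨(s, q.1), mem_product.2 ⟨hs, mem_offDiag.2 ⟨hq'.1, hq'.2.1, hq'.2.2.1⟩⟩,
        mem_image.2 ⟨q.2, mem_filter.2 ⟨hq'.2.2.2.1, hsC⟩, rfl⟩⟩
    refine (card_le_card hsub).trans ((card_biUnion_le_card_mul _ _ 2 ?_).trans ?_)
    · rintro ⟨s, u, u'⟩ hx
      rw [mem_product, mem_offDiag] at hx
      obtain ⟨hs, -, -, huu'⟩ := hx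
      dsimp only at hs huu' ⊢
      refine card_image_le.trans ?_
      rcases ({c ∈ B | s ∈ C u u' c} : Finset Circle).eq_empty_or_nonempty with h0 | ⟨c, hc⟩
      · rw [h0]
        simp
      · refine (card_le_card (t := {c, u * u' / c}) fun c' hc' => ?_).trans card_le_two
        rw [mem_filter] at hc hc'
        have hs' := ((hS s).1 hs).2
        have hsne : ∀ w : Circle, z + r₁ * w ≠ s := fun w h =>
          hs' (Or.inl ((mem_sphere_iff_exists_circle h₁).2 ⟨w, h⟩))
        have hCC : C u u' c = C u u' c' :=
          (hC u u' c).eq_of_mem (hC u u' c') (fun h => huu' (add_mul_circle_injective z h₁ h))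
            (hsne u) (hsne u') (hCu _ _ _) (hCu' _ _ _) hc.2 (hCu _ _ _) (hCu' _ _ _) hc'.2
        have := hmem₂ u u' c c' huu' (hCC ▸ hCv u u' c')
        simpa using this
    · rw [card_product]
      refine Nat.mul_le_mul_right 2 (Nat.mul_le_mul_left _ ?_)
      rw [offDiag_card, sq]
      exact Nat.sub_le _ _
  have hfin := finite_setOf_isGenCircle_ncard_eq_three P
  have hcard₂ : #Q₂ ≤ 2 * ordinaryGenCircles (P : Set ℂ) := by
    rw [ordinaryGenCircles, Set.ncard_eq_toFinset_card _ hfin]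
    refine card_le_mul_card_image_of_maps_to (f := fun q => C q.1.1 q.1.2 q.2) ?_ 2 ?_
    · rintro ⟨⟨u, u'⟩, v⟩ hq
      rw [hQ₂, mem_filter] at hq
      obtain ⟨hu, hu', huu', hv, hv'⟩ := hQmem _ hq.1
      dsimp only at *
      rw [Set.Finite.mem_toFinset]
      refine ⟨hC u u' v, ?_⟩
      rw [show C u u' v ∩ P = {z + r₁ * (u : ℂ), z + r₁ * (u' : ℂ), z + r₂ * (v : ℂ)} from ?_]
      · exact Set.ncard_eq_three.2 ⟨_, _, _, fun h => huu' (add_mul_circle_injective z h₁ h),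
          add_mul_circle_ne z h₁ h₂ hr _ _, add_mul_circle_ne z h₁ h₂ hr _ _, rfl⟩
      · ext w
        simp only [Set.mem_inter_iff, Set.mem_insert_iff, Set.mem_singleton_iff, mem_coe]
        constructor
        · rintro ⟨hwC, hwP⟩
          have hwS : w ∉ S := fun h => hq.2 ⟨w, h, hwC⟩
          rw [hS] at hwS
          push Not at hwS
          rcases hwS hwP with hw | hw
          · obtain ⟨x, rfl⟩ := (mem_sphere_iff_exists_circle h₁).1 hw
            rcases hmem₁ u u' v x huu' hwC with rfl | rfl <;> simp
          · obtain ⟨x, rfl⟩ := (mem_sphere_iff_exists_circle h₂).1 hw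
            rcases hmem₂ u u' v x huu' hwC with rfl | rfl
            · simp
            · exact absurd ((hB _).2 hwP) hv'
        · rintro (rfl | rfl | rfl)
          · exact ⟨hCu _ _ _, (hA _).1 hu⟩
          · exact ⟨hCu' _ _ _, (hA _).1 hu'⟩
          · exact ⟨hCv _ _ _, (hB _).1 hv⟩
    · intro C' _
      rcases ({q ∈ Q₂ | C q.1.1 q.1.2 q.2 = C'} : Finset _).eq_empty_or_nonempty with
        h0 | ⟨⟨⟨u, u'⟩, v⟩, hq⟩
      · rw [h0]
        simp
      · refine (card_le_card (t := {((u, u'), v), ((u', u), v)}) ?_).trans card_le_two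
        rintro ⟨⟨x, x'⟩, y⟩ hx
        rw [mem_filter] at hq hx
        obtain ⟨hu, hu', huu', hv, hv'⟩ := hQmem _ (mem_filter.1 hq.1).1
        obtain ⟨hx₁, hx', hxx', hy, hy'⟩ := hQmem _ (mem_filter.1 hx.1).1
        have hCC := hx.2.trans hq.2.symm
        dsimp only at *
        have e₁ := hmem₁ u u' v x huu' (hCC ▸ hCu x x' y)
        have e₂ := hmem₁ u u' v x' huu' (hCC ▸ hCu' x x' y)
        have e₃ : y = v := by
          rcases hmem₂ u u' v y huu' (hCC ▸ hCv x x' y) with h | h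
          · exact h
          · exact absurd (h ▸ hy) hv'
        subst e₃
        rcases e₁ with rfl | rfl <;> rcases e₂ with rfl | rfl <;> simp_all
  rw [hsum]
  omega

end Counting

section Structure

open Finset

lemma exists_circle_coe_eq_of_pow_eq {m : ℕ} (hm : m ≠ 0) {ζ : ℂ} {s : Circle} (h : ζ ^ m = s) :
    ∃ x : Circle, (x : ℂ) = ζ := by
  have hn : ‖ζ‖ = 1 := by
    rw [← pow_eq_one_iff_of_nonneg (norm_nonneg ζ) hm, ← norm_pow, h, Circle.norm_coe]
  obtain ⟨x, hx⟩ := (mem_sphere_iff_exists_circle (z := 0) one_pos).1 (mem_sphere_zero_iff_norm.2 hn)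
  exact ⟨x, by simpa using hx⟩

/-- Two cosets of a finite subgroup on concentric circles form an aligned or offset double polygon
if the square of their quotient is trivial. -/
lemma exists_doublePolygon {H : Subgroup Circle} {F : Finset Circle} (hF : ∀ x, x ∈ F ↔ x ∈ H)
    {a b : Circle} (hab : (a / b) ^ 2 ∈ H) (z : ℂ) {r₁ r₂ : ℝ} (h₁ : 0 < r₁) :
    ∃ V : Set ℂ, (V = alignedDoublePolygon #F (r₂ / r₁) ∨ V = offsetDoublePolygon #F (r₂ / r₁)) ∧
      ∀ w, w ∈ (fun ζ : ℂ => r₁ * (a : ℂ) * ζ + z) '' V ↔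
        (∃ x : Circle, x / a ∈ H ∧ z + r₁ * x = w) ∨ ∃ x : Circle, x / b ∈ H ∧ z + r₂ * x = w := by
  have hm : #F ≠ 0 := (card_pos.2 ⟨1, (hF 1).2 H.one_mem⟩).ne'
  have hr₁ : (r₁ : ℂ) ≠ 0 := by exact_mod_cast h₁.ne'
  have ha := Circle.coe_ne_zero a
  have hb := Circle.coe_ne_zero b
  have hH := Circle.mem_subgroup_iff_pow_eq_one hF
  set ε : ℂ := ((b / a : Circle) : ℂ) ^ #F with hε
  have hε2 : ε = 1 ∨ ε = -1 := by
    have h := (hH _).1 (H.inv_mem hab)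
    rw [← inv_pow, inv_div, Circle.coe_pow, pow_right_comm] at h
    exact sq_eq_one_iff.1 h
  refine ⟨{ζ | ζ ^ #F = 1} ∪ (fun ζ : ℂ => (r₂ / r₁ : ℝ) * ζ) '' {ζ | ζ ^ #F = ε}, ?_, fun w => ?_⟩
  · rw [alignedDoublePolygon_eq hm, offsetDoublePolygon_eq hm]
    rcases hε2 with h | h <;> simp [h]
  have hHa : ∀ x : Circle, x / a ∈ H ↔ ((x : ℂ) / a) ^ #F = 1 := fun x => by
    rw [hH, Circle.coe_div]
  have hHb : ∀ x : Circle, x / b ∈ H ↔ ((x : ℂ) / a) ^ #F = ε := fun x => by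
    rw [hH, hε, Circle.coe_div, Circle.coe_div, div_pow, div_pow, div_pow,
      div_eq_one_iff_eq (pow_ne_zero _ hb), div_left_inj' (pow_ne_zero _ ha)]
  rw [Set.image_union, Set.image_image]
  refine or_congr ⟨?_, ?_⟩ ⟨?_, ?_⟩
  · rintro ⟨ζ, hζ, rfl⟩
    obtain ⟨x, rfl⟩ := exists_circle_coe_eq_of_pow_eq hm (s := 1) (by simpa using hζ)
    refine ⟨a * x, ?_, ?_⟩
    · rwa [hHa, Circle.coe_mul, mul_div_cancel_left₀ _ ha]
    · push_cast
      ring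
  · rintro ⟨x, hx, rfl⟩
    refine ⟨x / a, (hHa x).1 hx, ?_⟩
    field_simp
    ring
  · rintro ⟨ζ, hζ, rfl⟩
    obtain ⟨x, rfl⟩ := exists_circle_coe_eq_of_pow_eq (ζ := ζ) hm (s := (b / a) ^ #F) (by
      rw [Circle.coe_pow]
      exact hζ)
    refine ⟨a * x, ?_, ?_⟩
    · rwa [hHb, Circle.coe_mul, mul_div_cancel_left₀ _ ha]
    · push_cast
      field_simp
      ring
  · rintro ⟨x, hx, rfl⟩
    refine ⟨x / a, (hHb x).1 hx, ?_⟩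
    push_cast
    field_simp
    ring

open scoped Classical in
lemma exists_doublePolygon_ncard_symmDiff_le {K : ℝ} (hK : 0 < K) (P : Finset ℂ)
    (hn : 200000 * (K + 1) ≤ #P)
    (hord : (ordinaryGenCircles (P : Set ℂ) : ℝ) ≤ K * (#P : ℝ) ^ 2) {z : ℂ} {r₁ r₂ : ℝ}
    (h₁ : 0 < r₁) (hr : r₁ < r₂)
    (hout : (((P : Set ℂ) \ (Metric.sphere z r₁ ∪ Metric.sphere z r₂)).ncard : ℝ) ≤ K)
    (hin₁ : |(((P : Set ℂ) ∩ Metric.sphere z r₁).ncard : ℝ) - (#P : ℝ) / 2| ≤ K)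
    (hin₂ : |(((P : Set ℂ) ∩ Metric.sphere z r₂).ncard : ℝ) - (#P : ℝ) / 2| ≤ K) :
    ∃ (m : ℕ) (r : ℝ) (V : Set ℂ) (α β : ℂ), 2 ≤ m ∧ 1 < r ∧
      (V = alignedDoublePolygon m r ∨ V = offsetDoublePolygon m r) ∧ α ≠ 0 ∧
      ((symmDiff (P : Set ℂ) ((fun z => α * z + β) '' V)).ncard : ℝ) ≤ 9000 * K := by
  have h₂ : 0 < r₂ := h₁.trans hr
  have hdir : ∀ r : ℝ, 0 < r → ∃ A : Finset Circle, (∀ u : Circle, u ∈ A ↔ z + r * u ∈ P) ∧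
      ((P : Set ℂ) ∩ Metric.sphere z r).ncard = #A := by
    intro r hr0
    refine ⟨P.preimage (fun u : Circle => z + r * (u : ℂ)) (add_mul_circle_injective z hr0).injOn,
      fun u => mem_preimage, ?_⟩
    rw [← card_image_of_injective _ (add_mul_circle_injective z hr0), ← Set.ncard_coe_finset]
    congr 1
    ext w
    rw [Set.mem_inter_iff, mem_sphere_iff_exists_circle hr0, mem_coe, mem_coe, mem_image]
    constructor
    · rintro ⟨hw, u, rfl⟩
      exact ⟨u, mem_preimage.2 hw, rfl⟩
    · rintro ⟨u, hu, rfl⟩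
      exact ⟨by simpa using hu, u, rfl⟩
  obtain ⟨A, hA, hAcard⟩ := hdir r₁ h₁
  obtain ⟨B, hB, hBcard⟩ := hdir r₂ h₂
  rw [hAcard, abs_le] at hin₁
  rw [hBcard, abs_le] at hin₂
  set S : Finset ℂ := {w ∈ P | w ∉ Metric.sphere z r₁ ∪ Metric.sphere z r₂} with hS
  have hScard : (#S : ℝ) ≤ K := by
    have : (P : Set ℂ) \ (Metric.sphere z r₁ ∪ Metric.sphere z r₂) = S := by
      ext w
      simp [hS]
    rwa [this, Set.ncard_coe_finset] at hout
  have hsum := sum_reflectionDefect_le P z h₁ h₂ hr.ne A B S hA hB (fun w => by rw [hS, mem_filter])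
  have hsum' : ∑ p ∈ A.offDiag, (reflectionDefect B (p.1 * p.2) : ℝ) ≤ 34 * K * (#A : ℝ) ^ 2 := by
    have h : ∑ p ∈ A.offDiag, (reflectionDefect B (p.1 * p.2) : ℝ) ≤
        2 * ordinaryGenCircles (P : Set ℂ) + 2 * (#S * (#A : ℝ) ^ 2) := by exact_mod_cast hsum
    have hPA : (#P : ℝ) ^ 2 ≤ 16 * (#A : ℝ) ^ 2 := by
      have : (#P : ℝ) ≤ 4 * #A := by linarith
      nlinarith [(Nat.cast_nonneg #P : (0 : ℝ) ≤ #P)]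
    have hSA := mul_le_mul_of_nonneg_right hScard (sq_nonneg (#A : ℝ))
    have hKP := mul_le_mul_of_nonneg_left hPA hK.le
    linarith
  obtain ⟨H, F, a, b, hF, hab, hF2, hAa, hFa, hBb, hFb⟩ := exists_near_cosets A B (34 * K)
    (by linarith) (by linarith) (by linarith) (by linarith) hsum'
  obtain ⟨V, hV, hTV⟩ := exists_doublePolygon hF hab z (r₂ := r₂) h₁
  refine ⟨#F, r₂ / r₁, V, r₁ * a, z, hF2, (one_lt_div h₁).2 hr, hV,
    mul_ne_zero (by exact_mod_cast h₁.ne') (Circle.coe_ne_zero a), ?_⟩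
  set f₁ : Circle → ℂ := fun u => z + r₁ * u
  set f₂ : Circle → ℂ := fun u => z + r₂ * u
  set E₁ := ({x ∈ A | x / a ∉ H} : Finset Circle).image f₁
  set E₂ := ({t ∈ F | t * a ∉ A} : Finset Circle).image fun t => f₁ (t * a)
  set E₃ := ({x ∈ B | x / b ∉ H} : Finset Circle).image f₂
  set E₄ := ({t ∈ F | t * b ∉ B} : Finset Circle).image fun t => f₂ (t * b)
  have hsub : symmDiff (P : Set ℂ) ((fun ζ : ℂ => r₁ * (a : ℂ) * ζ + z) '' V) ⊆
      ((S ∪ (E₁ ∪ E₂ ∪ (E₃ ∪ E₄)) : Finset ℂ) : Set ℂ) := by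
    rintro w (⟨hw, hw'⟩ | ⟨hw, hw'⟩)
    · rw [hTV] at hw'
      push Not at hw'
      rw [mem_coe] at hw ⊢
      by_cases hwS : w ∈ Metric.sphere z r₁ ∪ Metric.sphere z r₂
      · rcases hwS with hws | hws
        · obtain ⟨u, rfl⟩ := (mem_sphere_iff_exists_circle h₁).1 hws
          have : z + r₁ * (u : ℂ) ∈ E₁ := mem_image_of_mem f₁
            (mem_filter.2 ⟨(hA u).2 hw, fun h => hw'.1 u h rfl⟩)
          simp [this]
        · obtain ⟨u, rfl⟩ := (mem_sphere_iff_exists_circle h₂).1 hws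
          have : z + r₂ * (u : ℂ) ∈ E₃ := mem_image_of_mem f₂
            (mem_filter.2 ⟨(hB u).2 hw, fun h => hw'.2 u h rfl⟩)
          simp [this]
      · exact mem_union_left _ (mem_filter.2 ⟨hw, hwS⟩)
    · rw [mem_coe] at hw' ⊢
      rcases (hTV w).1 hw with ⟨x, hx, rfl⟩ | ⟨x, hx, rfl⟩
      · have : z + r₁ * (x : ℂ) ∈ E₂ := mem_image.2 ⟨x / a, mem_filter.2 ⟨(hF _).2 hx, by
          rwa [div_mul_cancel, hA]⟩, by rw [div_mul_cancel]⟩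
        simp [this]
      · have : z + r₂ * (x : ℂ) ∈ E₄ := mem_image.2 ⟨x / b, mem_filter.2 ⟨(hF _).2 hx, by
          rwa [div_mul_cancel, hB]⟩, by rw [div_mul_cancel]⟩
        simp [this]
  have hcard := Set.ncard_le_ncard hsub (finite_toSet _)
  rw [Set.ncard_coe_finset] at hcard
  have hle : #(S ∪ (E₁ ∪ E₂ ∪ (E₃ ∪ E₄))) ≤ #S + (#{x ∈ A | x / a ∉ H} + #{t ∈ F | t * a ∉ A} +
      (#{x ∈ B | x / b ∉ H} + #{t ∈ F | t * b ∉ B})) :=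
    (card_union_le _ _).trans <| Nat.add_le_add_left ((card_union_le _ _).trans <| Nat.add_le_add
      ((card_union_le _ _).trans <| Nat.add_le_add card_image_le card_image_le)
      ((card_union_le _ _).trans <| Nat.add_le_add card_image_le card_image_le)) _
  have hle' : ((symmDiff (P : Set ℂ) ((fun ζ : ℂ => r₁ * (a : ℂ) * ζ + z) '' V)).ncard : ℝ) ≤
      #S + (#{x ∈ A | x / a ∉ H} + #{t ∈ F | t * a ∉ A} +
      (#{x ∈ B | x / b ∉ H} + #{t ∈ F | t * b ∉ B})) := by exact_mod_cast hcard.trans hle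
  linarith

end Structure

/-- A set of `n` points with at most `Kn²` ordinary generalised circles, lying mostly on
two concentric circles with roughly `n/2` points on each, differs in at most `O(K)`
points from a directly similar copy of an aligned or offset double polygon. -/
theorem concentric_circles_structure :
    ∃ c : ℝ, ∀ K : ℝ, 0 < K → ∃ N : ℕ, ∀ n : ℕ, N ≤ n →
      ∀ P : Finset ℂ, P.card = n →
        (ordinaryGenCircles (P : Set ℂ) : ℝ) ≤ K * (n : ℝ) ^ 2 →
        (∃ (z : ℂ) (r₁ r₂ : ℝ), 0 < r₁ ∧ 0 < r₂ ∧
          ((((P : Set ℂ) \ (Metric.sphere z r₁ ∪ Metric.sphere z r₂)).ncard : ℝ) ≤ K) ∧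
          |(((P : Set ℂ) ∩ Metric.sphere z r₁).ncard : ℝ) - (n : ℝ) / 2| ≤ K ∧
          |(((P : Set ℂ) ∩ Metric.sphere z r₂).ncard : ℝ) - (n : ℝ) / 2| ≤ K) →
        ∃ (m : ℕ) (r : ℝ) (V : Set ℂ) (α β : ℂ),
          2 ≤ m ∧ 1 < r ∧
          (V = alignedDoublePolygon m r ∨ V = offsetDoublePolygon m r) ∧
          α ≠ 0 ∧
          ((symmDiff (P : Set ℂ) ((fun z => α * z + β) '' V)).ncard : ℝ) ≤ c * K := by
  refine ⟨9000, fun K hK => ⟨⌈200000 * (K + 1)⌉₊, fun n hn P hP hord ⟨z, r₁, r₂, h₁, h₂, hout, hin₁,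
    hin₂⟩ => ?_⟩⟩
  subst hP
  have hn' : 200000 * (K + 1) ≤ (P.card : ℝ) := Nat.ceil_le.1 hn
  rcases lt_trichotomy r₁ r₂ with hr | rfl | hr
  · exact exists_doublePolygon_ncard_symmDiff_le hK P hn' hord h₁ hr hout hin₁ hin₂
  · rw [Set.union_self] at hout
    have h := Set.ncard_inter_add_ncard_sdiff_eq_ncard (P : Set ℂ) (Metric.sphere z r₁)
      P.finite_toSet
    rw [Set.ncard_coe_finset] at h
    have h' : (((P : Set ℂ) ∩ Metric.sphere z r₁).ncard : ℝ) +
        ((P : Set ℂ) \ Metric.sphere z r₁).ncard = P.card := by exact_mod_cast h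
    rw [abs_le] at hin₁
    linarith
  · rw [Set.union_comm] at hout
    exact exists_doublePolygon_ncard_symmDiff_le hK P hn' hord h₂ hr hout hin₂ hin₁
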